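/- arXiv:1508.04591 — 13 statements merged into one kernel-verified Lean document; each statement's English description precedes it below -/
import Mathlib

section
/- Let α : I → ℝ³ be a smooth curve in the 3-dimensional Minkowski spacetime defined on an open interval I, and suppose f : I → ℝ is a smooth function with f(s) ≠ 0 and f'(s) ≠ 0 for all s ∈ I, ε ∈ {1, -1}, and the derivative of α satisfies α'(s) = (ε/(2 f'(s))) · (2 f(s), f(s)² − 1, f(s)² + 1) for all s ∈ I. Then α is a null curve parametrized by pseudo-arc, i.e. g(α'(s), α'(s)) = 0 and g(α''(s), α''(s)) = 1 for all s ∈ I. -/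
open Real Set

noncomputable section

/-- The Minkowski bilinear form on ℝ³: g(u,v) = u₁v₁ + u₂v₂ − u₃v₃. -/
def mg (u v : ℝ × ℝ × ℝ) : ℝ := u.1 * v.1 + u.2.1 * v.2.1 - u.2.2 * v.2.2

theorem mg_smul_smul (a b : ℝ) (u v : ℝ × ℝ × ℝ) : mg (a • u) (b • v) = a * b * mg u v := by
  simp only [mg, Prod.smul_fst, Prod.smul_snd, smul_eq_mul]
  ring

theorem mg_self_null_lift (x : ℝ) :
    mg (2 * x, x ^ 2 - 1, x ^ 2 + 1) (2 * x, x ^ 2 - 1, x ^ 2 + 1) = 0 := by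
  simp only [mg]
  ring

theorem hasDerivAt_null_lift {f : ℝ → ℝ} {f' s : ℝ} (hf : HasDerivAt f f' s) :
    HasDerivAt (fun t => ((2 * f t, f t ^ 2 - 1, f t ^ 2 + 1) : ℝ × ℝ × ℝ))
      (2 * f', 2 * f s * f', 2 * f s * f') s := by
  have hsq : HasDerivAt (fun t => f t ^ 2) (2 * f s * f') s := by
    simpa using hf.fun_pow 2
  exact (hf.const_mul 2).prodMk ((hsq.sub_const 1).prodMk (hsq.add_const 1))

theorem null_and_pseudo_arc_of_deriv_formula
    (I : Set ℝ) (hIopen : IsOpen I) (hIord : I.OrdConnected)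
    (α : ℝ → ℝ × ℝ × ℝ) (hα : ContDiffOn ℝ (⊤ : ℕ∞) α I)
    (f : ℝ → ℝ) (hf : ContDiffOn ℝ (⊤ : ℕ∞) f I)
    (hf0 : ∀ s ∈ I, f s ≠ 0) (hf'0 : ∀ s ∈ I, deriv f s ≠ 0)
    (ε : ℝ) (hε : ε = 1 ∨ ε = -1)
    (hα' : ∀ s ∈ I, deriv α s =
      (ε / (2 * deriv f s)) • ((2 * f s, f s ^ 2 - 1, f s ^ 2 + 1) : ℝ × ℝ × ℝ)) :
    ∀ s ∈ I, mg (deriv α s) (deriv α s) = 0 ∧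
      mg (deriv (deriv α) s) (deriv (deriv α) s) = 1 := by
  intro s hs
  refine ⟨by rw [hα' s hs, mg_smul_smul, mg_self_null_lift, mul_zero], ?_⟩
  have hnhds : I ∈ nhds s := hIopen.mem_nhds hs
  have hfs : ContDiffAt ℝ (⊤ : ℕ∞) f s := hf.contDiffAt hnhds
  have hfd : HasDerivAt f (deriv f s) s := (hfs.differentiableAt (by simp)).hasDerivAt
  have hf'd : DifferentiableAt ℝ (deriv f) s :=
    ((hf.deriv_of_isOpen (m := (⊤ : ℕ∞)) hIopen le_rfl).contDiffAt
      hnhds).differentiableAt (by simp)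
  have hne : deriv f s ≠ 0 := hf'0 s hs
  have hc : DifferentiableAt ℝ (fun t => ε / (2 * deriv f t)) s :=
    (differentiableAt_const ε).div (hf'd.const_mul 2) (mul_ne_zero two_ne_zero hne)
  have heq : deriv α =ᶠ[nhds s] fun t =>
      (ε / (2 * deriv f t)) • ((2 * f t, f t ^ 2 - 1, f t ^ 2 + 1) : ℝ × ℝ × ℝ) :=
    Filter.eventually_of_mem hnhds hα'
  have hε2 : ε ^ 2 = 1 := by rcases hε with rfl | rfl <;> norm_num
  rw [heq.deriv_eq, (hc.hasDerivAt.fun_smul (hasDerivAt_null_lift hfd)).deriv]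
  generalize deriv (fun t => ε / (2 * deriv f t)) s = c
  simp only [mg, Prod.smul_mk, Prod.mk_add_mk, smul_eq_mul]
  field_simp
  linear_combination hε2
end
end

section
/- Let α : I → ℝ³ be a smooth curve in the 3-dimensional Minkowski spacetime defined on an open interval I, and suppose f : I → ℝ is a smooth function with f(s) ≠ 0 and f'(s) ≠ 0 for all s ∈ I, ε ∈ {1, -1}, and α'(s) = (ε/(2 f'(s))) · (2 f(s), f(s)² − 1, f(s)² + 1) for all s ∈ I. Then the torsion of α equals the Schwarzian derivative of f, that is, (1/2) g(α'''(s), α'''(s)) = (f''(s)/f'(s))' − (1/2)(f''(s)/f'(s))² for all s ∈ I. -/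
open Real Set

noncomputable section

/-- The lifted null vector `(2x, x² − 1, x² + 1)` along a function `f`, differentiated. -/
theorem hasDerivAt_nullLift {f : ℝ → ℝ} {b s : ℝ} (hf : HasDerivAt f b s) :
    HasDerivAt (fun t => ((2 * f t, f t ^ 2 - 1, f t ^ 2 + 1) : ℝ × ℝ × ℝ))
      (b • (2, 2 * f s, 2 * f s)) s := by
  have h2 := hf.fun_pow 2
  refine ((hf.const_mul 2).prodMk ((h2.sub_const 1).prodMk (h2.add_const 1))).congr_deriv ?_
  ext <;> simp <;> ring

theorem hasDerivAt_nullLift_tangent {f : ℝ → ℝ} {b s : ℝ} (hf : HasDerivAt f b s) :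
    HasDerivAt (fun t => ((2, 2 * f t, 2 * f t) : ℝ × ℝ × ℝ)) (b • (0, 2, 2)) s := by
  have h2 := hf.const_mul 2
  refine ((hasDerivAt_const s 2).prodMk (h2.prodMk h2)).congr_deriv ?_
  ext <;> simp <;> ring

theorem torsion_eq_schwarzian
    (I : Set ℝ) (hIopen : IsOpen I) (hIord : I.OrdConnected)
    (α : ℝ → ℝ × ℝ × ℝ) (hα : ContDiffOn ℝ (⊤ : ℕ∞) α I)
    (f : ℝ → ℝ) (hf : ContDiffOn ℝ (⊤ : ℕ∞) f I)
    (hf0 : ∀ s ∈ I, f s ≠ 0) (hf'0 : ∀ s ∈ I, deriv f s ≠ 0)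
    (ε : ℝ) (hε : ε = 1 ∨ ε = -1)
    (hα' : ∀ s ∈ I, deriv α s =
      (ε / (2 * deriv f s)) • ((2 * f s, f s ^ 2 - 1, f s ^ 2 + 1) : ℝ × ℝ × ℝ)) :
    ∀ s ∈ I,
      (1 / 2) * mg (deriv (deriv (deriv α)) s) (deriv (deriv (deriv α)) s) =
        deriv (fun t => deriv (deriv f) t / deriv f t) s
          - (1 / 2) * (deriv (deriv f) s / deriv f s) ^ 2 := by
  intro s hs
  have hf1 : ContDiffOn ℝ (⊤ : ℕ∞) (deriv f) I := hf.deriv_of_isOpen hIopen (by simp)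
  have hf2 : ContDiffOn ℝ (⊤ : ℕ∞) (deriv (deriv f)) I := hf1.deriv_of_isOpen hIopen (by simp)
  have hasDeriv {g : ℝ → ℝ} (hg : ContDiffOn ℝ (⊤ : ℕ∞) g I) {t : ℝ} (ht : t ∈ I) :
      HasDerivAt g (deriv g t) t :=
    ((hg.differentiableOn (by simp)).differentiableAt (hIopen.mem_nhds ht)).hasDerivAt
  have deriv_eq {u v v' : ℝ → ℝ × ℝ × ℝ} (huv : EqOn u v I)
      (hv : ∀ t ∈ I, HasDerivAt v (v' t) t) : EqOn (deriv u) v' I := fun t ht =>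
    ((hv t ht).congr_of_eventuallyEq (huv.eventuallyEq_of_mem (hIopen.mem_nhds ht))).deriv
  have hα'' : EqOn (deriv (deriv α)) (fun t =>
      (-(ε * deriv (deriv f) t) / (2 * deriv f t ^ 2)) •
          ((2 * f t, f t ^ 2 - 1, f t ^ 2 + 1) : ℝ × ℝ × ℝ)
        + (ε / 2) • ((2, 2 * f t, 2 * f t) : ℝ × ℝ × ℝ)) I := by
    refine deriv_eq hα' fun t ht => ?_
    have hb := hf'0 t ht
    have h := ((hasDerivAt_const t ε).fun_div ((hasDeriv hf1 ht).const_mul 2)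
      (mul_ne_zero two_ne_zero hb)).fun_smul (hasDerivAt_nullLift (hasDeriv hf ht))
    refine h.congr_deriv ?_
    ext <;> simp <;> field_simp <;> ring
  have hα''' : EqOn (deriv (deriv (deriv α))) (fun t =>
      (-(ε * deriv (deriv (deriv f)) t) / (2 * deriv f t ^ 2)
          + ε * deriv (deriv f) t ^ 2 / deriv f t ^ 3) •
          ((2 * f t, f t ^ 2 - 1, f t ^ 2 + 1) : ℝ × ℝ × ℝ)
        + (-(ε * deriv (deriv f) t) / (2 * deriv f t)) • ((2, 2 * f t, 2 * f t) : ℝ × ℝ × ℝ)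
        + (ε / 2 * deriv f t) • ((0, 2, 2) : ℝ × ℝ × ℝ)) I := by
    refine deriv_eq hα'' fun t ht => ?_
    have hb := hf'0 t ht
    have h := ((((hasDeriv hf2 ht).const_mul ε).fun_neg.fun_div
      (((hasDeriv hf1 ht).fun_pow 2).const_mul 2)
      (mul_ne_zero two_ne_zero (pow_ne_zero 2 hb))).fun_smul
      (hasDerivAt_nullLift (hasDeriv hf ht))).fun_add
      ((hasDerivAt_nullLift_tangent (hasDeriv hf ht)).fun_const_smul (ε / 2))
    refine h.congr_deriv ?_
    ext <;> simp <;> field_simp <;> ring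
  have hb := hf'0 s hs
  have hε2 : ε ^ 2 = 1 := by rcases hε with rfl | rfl <;> norm_num
  rw [hα''' hs, ((hasDeriv hf2 hs).fun_div (hasDeriv hf1 hs) hb).deriv]
  simp only [mg, Prod.fst_add, Prod.snd_add, Prod.smul_fst, Prod.smul_snd, smul_eq_mul]
  field_simp
  ring_nf
  simp only [hε2]
  ring
end
end

section
/- Let α : I → ℝ³, α(s) = (x(s), y(s), z(s)), be a smooth curve on an open interval I satisfying x'(s)² + y'(s)² − z'(s)² = 0 and x''(s)² + y''(s)² − z''(s)² = 1 for all s ∈ I, and suppose x'(s) ≠ 0, y'(s) ≠ 0 and z'(s) ≠ 0 for all s ∈ I. Then there exist a smooth function f : I → ℝ with f(s) ≠ 0 and f'(s) ≠ 0 on I and a sign ε ∈ {1, -1} such that α'(s) = (ε/(2 f'(s))) · (2 f(s), f(s)² − 1, f(s)² + 1) for all s ∈ I. -/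
open Real Set

noncomputable section

/-- On an open set, the derivative of a smooth function is smooth. -/
lemma ContDiffOn.deriv_top {g : ℝ → ℝ} {I : Set ℝ} (hg : ContDiffOn ℝ (⊤ : ℕ∞) g I)
    (hI : IsOpen I) : ContDiffOn ℝ (⊤ : ℕ∞) (deriv g) I :=
  hg.deriv_of_isOpen hI (by simp)

/-- Smooth functions on an open set have a derivative at each point of the set. -/
lemma ContDiffOn.hasDerivAt_deriv {g : ℝ → ℝ} {I : Set ℝ} (hg : ContDiffOn ℝ (⊤ : ℕ∞) g I)
    (hI : IsOpen I) {s : ℝ} (hs : s ∈ I) : HasDerivAt g (deriv g s) s :=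
  ((hg.contDiffAt (hI.mem_nhds hs)).differentiableAt (by simp)).hasDerivAt

/-- If `(u, v, w)` is null, `(u', v', w')` is a unit spacelike vector and the two are
orthogonal, then the Wronskian of `u` and `w - v` is `± (w - v)`. -/
lemma wronskian_sq_eq_of_null {u v w u' v' w' : ℝ}
    (hnull : u ^ 2 + v ^ 2 - w ^ 2 = 0) (horth : u * u' + v * v' - w * w' = 0)
    (hunit : u' ^ 2 + v' ^ 2 - w' ^ 2 = 1) :
    (u' * (w - v) - u * (w' - v')) ^ 2 = (w - v) ^ 2 := by
  linear_combination (w' - v') ^ 2 * hnull - 2 * (w - v) * (w' - v') * horth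
    + (w - v) ^ 2 * hunit

theorem exists_f_eps_of_null_pseudo_arc
    (I : Set ℝ) (hIopen : IsOpen I) (hIord : I.OrdConnected)
    (x y z : ℝ → ℝ)
    (hx : ContDiffOn ℝ (⊤ : ℕ∞) x I) (hy : ContDiffOn ℝ (⊤ : ℕ∞) y I) (hz : ContDiffOn ℝ (⊤ : ℕ∞) z I)
    (α : ℝ → ℝ × ℝ × ℝ) (hα : ∀ s, α s = (x s, y s, z s))
    (hnull : ∀ s ∈ I, deriv x s ^ 2 + deriv y s ^ 2 - deriv z s ^ 2 = 0)
    (hpa : ∀ s ∈ I,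
      deriv (deriv x) s ^ 2 + deriv (deriv y) s ^ 2 - deriv (deriv z) s ^ 2 = 1)
    (hx0 : ∀ s ∈ I, deriv x s ≠ 0) (hy0 : ∀ s ∈ I, deriv y s ≠ 0)
    (hz0 : ∀ s ∈ I, deriv z s ≠ 0) :
    ∃ f : ℝ → ℝ, ∃ ε : ℝ, ContDiffOn ℝ (⊤ : ℕ∞) f I ∧
      (∀ s ∈ I, f s ≠ 0) ∧ (∀ s ∈ I, deriv f s ≠ 0) ∧ (ε = 1 ∨ ε = -1) ∧
      ∀ s ∈ I, deriv α s =
        (ε / (2 * deriv f s)) • ((2 * f s, f s ^ 2 - 1, f s ^ 2 + 1) : ℝ × ℝ × ℝ) := by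
  have hu := hx.deriv_top hIopen
  have hv := hy.deriv_top hIopen
  have hw := hz.deriv_top hIopen
  have hwv : ∀ s ∈ I, deriv z s - deriv y s ≠ 0 := fun s hs h ↦ by
    have hsq : deriv x s ^ 2 = 0 := by
      linear_combination hnull s hs + (deriv z s + deriv y s) * h
    exact hx0 s hs (pow_eq_zero_iff two_ne_zero |>.mp hsq)
  have horth : ∀ s ∈ I, deriv x s * deriv (deriv x) s + deriv y s * deriv (deriv y) s
      - deriv z s * deriv (deriv z) s = 0 := fun s hs ↦ by
    have h := (((hu.hasDerivAt_deriv hIopen hs).pow 2).add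
      ((hv.hasDerivAt_deriv hIopen hs).pow 2)).sub ((hw.hasDerivAt_deriv hIopen hs).pow 2)
    have h0 := (hasDerivAt_const s (0 : ℝ)).congr_of_eventuallyEq
      (Filter.eventuallyEq_of_mem (hIopen.mem_nhds hs) hnull)
    have heq := h.unique h0
    norm_num at heq
    linarith
  let f : ℝ → ℝ := fun s ↦ deriv x s / (deriv z s - deriv y s)
  have hf : ContDiffOn ℝ (⊤ : ℕ∞) f I := hu.div (hw.sub hv) hwv
  have hf' : ∀ s ∈ I, deriv f s = (deriv (deriv x) s * (deriv z s - deriv y s)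
      - deriv x s * (deriv (deriv z) s - deriv (deriv y) s)) / (deriv z s - deriv y s) ^ 2 :=
    fun s hs ↦ ((hu.hasDerivAt_deriv hIopen hs).div
      ((hw.hasDerivAt_deriv hIopen hs).sub (hv.hasDerivAt_deriv hIopen hs)) (hwv s hs)).deriv
  let h : ℝ → ℝ := fun s ↦ (deriv z s - deriv y s) * deriv f s
  have hh : ContinuousOn h I :=
    ((hw.sub hv).mul (hf.deriv_top hIopen)).continuousOn
  have hsq : ∀ s ∈ I, h s ^ 2 = 1 := fun s hs ↦ by
    have key := wronskian_sq_eq_of_null (hnull s hs) (horth s hs) (hpa s hs)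
    have hd := hwv s hs
    simp only [h]
    rw [mul_pow, hf' s hs, div_pow, key]
    field_simp
  obtain ⟨ε, hε, hhε⟩ : ∃ ε : ℝ, (ε = 1 ∨ ε = -1) ∧ ∀ s ∈ I, h s = ε := by
    rcases hIord.isPreconnected.eq_one_or_eq_neg_one_of_sq_eq hh hsq with h1 | h1
    · exact ⟨1, Or.inl rfl, h1⟩
    · exact ⟨-1, Or.inr rfl, h1⟩
  have hε0 : ε ≠ 0 := by rcases hε with rfl | rfl <;> norm_num
  have hf0 : ∀ s ∈ I, deriv f s ≠ 0 := fun s hs h0 ↦ hε0 <| by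
    rw [← hhε s hs]
    simp [h, h0]
  refine ⟨f, ε, hf, fun s hs ↦ div_ne_zero (hx0 s hs) (hwv s hs), hf0, hε, fun s hs ↦ ?_⟩
  have hαd : deriv α s = (deriv x s, deriv y s, deriv z s) := by
    rw [funext hα]
    exact ((hx.hasDerivAt_deriv hIopen hs).prodMk
      ((hy.hasDerivAt_deriv hIopen hs).prodMk (hz.hasDerivAt_deriv hIopen hs))).deriv
  have hcoef : ε / (2 * deriv f s) = (deriv z s - deriv y s) / 2 := by
    have := hf0 s hs
    rw [← hhε s hs]
    simp only [h]
    field_simp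
  have hd := hwv s hs
  have hn := hnull s hs
  rw [hαd, hcoef]
  simp only [f, Prod.smul_mk, smul_eq_mul, Prod.mk.injEq]
  refine ⟨by field_simp, ?_, ?_⟩
  · field_simp
    linear_combination -hn
  · field_simp
    linear_combination -hn
end
end

section
/- Let x, y, z : I → ℝ be smooth functions on an open interval I with x'(s) ≠ 0, y'(s) ≠ 0, z'(s) ≠ 0 for all s ∈ I, satisfying x'(s)² + y'(s)² − z'(s)² = 0 on I. Then there exist smooth nonvanishing functions f, h : I → ℝ such that x' = h, y' = (h/2)(f − 1/f) and z' = (h/2)(f + 1/f) on I; moreover, if in addition x''(s)² + y''(s)² − z''(s)² = 1 on I, then h(s)² f'(s)² = f(s)² on I, so f' is nonvanishing and h = ε f/f' for some ε ∈ {1, -1}. -/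
open Real Set

noncomputable section

/-- The derivative identity for the quotient `(b + c) / a` along a null curve `a² + b² = c²`
whose velocity has unit Lorentzian square. -/
theorem sq_mul_sq_deriv_quotient_of_null {a b c a' b' c' : ℝ} (ha : a ≠ 0)
    (hnull : a ^ 2 + b ^ 2 - c ^ 2 = 0) (horth : a * a' + b * b' - c * c' = 0)
    (hunit : a' ^ 2 + b' ^ 2 - c' ^ 2 = 1) :
    a ^ 2 * (((b' + c') * a - (b + c) * a') / a ^ 2) ^ 2 = ((b + c) / a) ^ 2 := by
  field_simp
  linear_combination (b' + c') ^ 2 * hnull - 2 * (b + c) * (b' + c') * horth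
    + (b + c) ^ 2 * hunit

theorem exists_f_h_factorization
    (I : Set ℝ) (hIopen : IsOpen I) (hIord : I.OrdConnected)
    (x y z : ℝ → ℝ)
    (hx : ContDiffOn ℝ (⊤ : ℕ∞) x I) (hy : ContDiffOn ℝ (⊤ : ℕ∞) y I) (hz : ContDiffOn ℝ (⊤ : ℕ∞) z I)
    (hx0 : ∀ s ∈ I, deriv x s ≠ 0) (hy0 : ∀ s ∈ I, deriv y s ≠ 0)
    (hz0 : ∀ s ∈ I, deriv z s ≠ 0)
    (hnull : ∀ s ∈ I, deriv x s ^ 2 + deriv y s ^ 2 - deriv z s ^ 2 = 0) :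
    ∃ f h : ℝ → ℝ, ContDiffOn ℝ (⊤ : ℕ∞) f I ∧ ContDiffOn ℝ (⊤ : ℕ∞) h I ∧
      (∀ s ∈ I, f s ≠ 0) ∧ (∀ s ∈ I, h s ≠ 0) ∧
      (∀ s ∈ I, deriv x s = h s) ∧
      (∀ s ∈ I, deriv y s = (h s / 2) * (f s - 1 / f s)) ∧
      (∀ s ∈ I, deriv z s = (h s / 2) * (f s + 1 / f s)) ∧
      ((∀ s ∈ I,
          deriv (deriv x) s ^ 2 + deriv (deriv y) s ^ 2 - deriv (deriv z) s ^ 2 = 1) →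
        (∀ s ∈ I, h s ^ 2 * deriv f s ^ 2 = f s ^ 2) ∧
        (∀ s ∈ I, deriv f s ≠ 0) ∧
        ∃ ε : ℝ, (ε = 1 ∨ ε = -1) ∧ ∀ s ∈ I, h s = ε * f s / deriv f s) := by
  have smooth_deriv : ∀ {u : ℝ → ℝ}, ContDiffOn ℝ (⊤ : ℕ∞) u I →
      ContDiffOn ℝ (⊤ : ℕ∞) (deriv u) I := fun hu =>
    hu.deriv_of_isOpen hIopen (by exact_mod_cast le_top)
  have hasDerivAt : ∀ {u : ℝ → ℝ}, ContDiffOn ℝ (⊤ : ℕ∞) u I → ∀ s ∈ I,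
      HasDerivAt u (deriv u s) s := fun hu s hs =>
    ((hu.contDiffAt (hIopen.mem_nhds hs)).differentiableAt (by simp)).hasDerivAt
  have hx' := smooth_deriv hx
  have hy' := smooth_deriv hy
  have hz' := smooth_deriv hz
  have hsum : ∀ s ∈ I, deriv y s + deriv z s ≠ 0 := fun s hs h =>
    hx0 s hs (pow_eq_zero_iff two_ne_zero |>.1
      (by linear_combination hnull s hs + (deriv z s - deriv y s) * h))
  set f : ℝ → ℝ := fun s => (deriv y s + deriv z s) / deriv x s with hf_def
  have hf : ContDiffOn ℝ (⊤ : ℕ∞) f I := (hy'.add hz').div hx' hx0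
  have hf0 : ∀ s ∈ I, f s ≠ 0 := fun s hs => div_ne_zero (hsum s hs) (hx0 s hs)
  refine ⟨f, deriv x, hf, hx', hf0, hx0, fun _ _ => rfl, fun s hs => ?_, fun s hs => ?_,
    fun hunit => ?_⟩
  · have := hx0 s hs
    have := hsum s hs
    simp only [hf_def]
    field_simp
    linear_combination hnull s hs
  · have := hx0 s hs
    have := hsum s hs
    simp only [hf_def]
    field_simp
    linear_combination -hnull s hs
  · have key : ∀ s ∈ I, deriv x s ^ 2 * deriv f s ^ 2 = f s ^ 2 := by
      intro s hs
      have dx := hasDerivAt hx' s hs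
      have dy := hasDerivAt hy' s hs
      have dz := hasDerivAt hz' s hs
      have horth := (((dx.pow 2).add (dy.pow 2)).sub (dz.pow 2)).unique
        ((hasDerivAt_const s (0 : ℝ)).congr_of_eventuallyEq
          (Filter.eventually_of_mem (hIopen.mem_nhds hs) hnull))
      have df : deriv f s = _ := ((dy.add dz).div dx (hx0 s hs)).deriv
      rw [df]
      refine sq_mul_sq_deriv_quotient_of_null (hx0 s hs) (hnull s hs) ?_ (hunit s hs)
      norm_num at horth
      linear_combination horth / 2
    have hdf0 : ∀ s ∈ I, deriv f s ≠ 0 := fun s hs h =>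
      hf0 s hs (pow_eq_zero_iff two_ne_zero |>.1 (by rw [← key s hs, h]; ring))
    refine ⟨key, hdf0, ?_⟩
    have hsq : EqOn ((fun s => deriv x s * deriv f s) ^ 2) (f ^ 2) I := fun s hs => by
      simpa [mul_pow] using key s hs
    rcases hIord.isPreconnected.eq_or_eq_neg_of_sq_eq
      (hx'.continuousOn.mul (smooth_deriv hf).continuousOn) hf.continuousOn hsq
      (fun {s} hs => hf0 s hs) with h | h
    · exact ⟨1, Or.inl rfl, fun s hs => by
        rw [eq_div_iff (hdf0 s hs), one_mul]; exact h hs⟩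
    · exact ⟨-1, Or.inr rfl, fun s hs => by
        rw [eq_div_iff (hdf0 s hs), neg_one_mul]; exact h hs⟩
end
end

section
/- Let α : I → ℝ³ be a smooth curve in the 3-dimensional Minkowski spacetime on an open interval I, f : I → ℝ smooth with f(s) ≠ 0 and f'(s) ≠ 0 on I, ε ∈ {1, -1}, and α'(s) = (ε/(2 f'(s))) · (2 f(s), f(s)² − 1, f(s)² + 1) for all s ∈ I. Then g(α'''(s), α'''(s)) = (2 f'(s) f'''(s) − 3 f''(s)²) / f'(s)² for all s ∈ I. -/
open Real Set

noncomputable section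

/-- The derivative of `c • (2f, f² - 1, f² + 1)`. -/
theorem hasDerivAt_smul_null_curve {c f : ℝ → ℝ} {c' f' s : ℝ}
    (hc : HasDerivAt c c' s) (hf : HasDerivAt f f' s) :
    HasDerivAt (fun t => c t • ((2 * f t, f t ^ 2 - 1, f t ^ 2 + 1) : ℝ × ℝ × ℝ))
      (c' • ((2 * f s, f s ^ 2 - 1, f s ^ 2 + 1) : ℝ × ℝ × ℝ) +
        (c s * f') • ((2, 2 * f s, 2 * f s) : ℝ × ℝ × ℝ)) s := by
  have hsq := hf.pow 2
  have h := hc.smul ((hf.const_mul 2).prodMk ((hsq.sub_const 1).prodMk (hsq.add_const 1)))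
  refine HasDerivAt.congr_deriv (f := fun t => c t • ((2 * f t, f t ^ 2 - 1, f t ^ 2 + 1) :
    ℝ × ℝ × ℝ)) h ?_
  ext <;> simp <;> ring

/-- On an open set, the derivative of a smooth function is smooth. -/
theorem ContDiffOn.deriv_of_isOpen_infty {f : ℝ → ℝ} {I : Set ℝ} (hI : IsOpen I)
    (hf : ContDiffOn ℝ (⊤ : ℕ∞) f I) : ContDiffOn ℝ (⊤ : ℕ∞) (deriv f) I :=
  hf.deriv_of_isOpen hI (by simp)

/-- A smooth function on an open set has its derivative there. -/
theorem ContDiffOn.hasDerivAt_of_isOpen {f : ℝ → ℝ} {I : Set ℝ} (hI : IsOpen I)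
    (hf : ContDiffOn ℝ (⊤ : ℕ∞) f I) {s : ℝ} (hs : s ∈ I) : HasDerivAt f (deriv f s) s :=
  ((hf.differentiableOn (by simp)).differentiableAt (hI.mem_nhds hs)).hasDerivAt

theorem mg_third_deriv_formula
    (I : Set ℝ) (hIopen : IsOpen I) (hIord : I.OrdConnected)
    (α : ℝ → ℝ × ℝ × ℝ) (hα : ContDiffOn ℝ (⊤ : ℕ∞) α I)
    (f : ℝ → ℝ) (hf : ContDiffOn ℝ (⊤ : ℕ∞) f I)
    (hf0 : ∀ s ∈ I, f s ≠ 0) (hf'0 : ∀ s ∈ I, deriv f s ≠ 0)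
    (ε : ℝ) (hε : ε = 1 ∨ ε = -1)
    (hα' : ∀ s ∈ I, deriv α s =
      (ε / (2 * deriv f s)) • ((2 * f s, f s ^ 2 - 1, f s ^ 2 + 1) : ℝ × ℝ × ℝ)) :
    ∀ s ∈ I,
      mg (deriv (deriv (deriv α)) s) (deriv (deriv (deriv α)) s) =
        (2 * deriv f s * deriv (deriv (deriv f)) s - 3 * deriv (deriv f) s ^ 2) /
          deriv f s ^ 2 := by
  have hf₁ := hf.deriv_of_isOpen_infty hIopen
  have hf₂ := hf₁.deriv_of_isOpen_infty hIopen
  have hα'' : ∀ s ∈ I, deriv (deriv α) s =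
      (-(ε * deriv (deriv f) s) / (2 * deriv f s ^ 2)) •
          ((2 * f s, f s ^ 2 - 1, f s ^ 2 + 1) : ℝ × ℝ × ℝ) +
        (ε / 2) • ((2, 2 * f s, 2 * f s) : ℝ × ℝ × ℝ) := by
    intro s hs
    have hne := hf'0 s hs
    have heq : deriv α =ᶠ[nhds s] _ := Filter.eventuallyEq_of_mem (hIopen.mem_nhds hs) hα'
    have hc : HasDerivAt (fun t => ε / (2 * deriv f t))
        (-(ε * deriv (deriv f) s) / (2 * deriv f s ^ 2)) s := by
      refine ((hasDerivAt_const s ε).fun_div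
        ((hf₁.hasDerivAt_of_isOpen hIopen hs).const_mul 2) (by simpa using hne)).congr_deriv ?_
      field_simp
      ring
    rw [heq.deriv_eq, (hasDerivAt_smul_null_curve hc (hf.hasDerivAt_of_isOpen hIopen hs)).deriv,
      show ε / (2 * deriv f s) * deriv f s = ε / 2 by field_simp]
  intro s hs
  have hne := hf'0 s hs
  have hd := hf.hasDerivAt_of_isOpen hIopen hs
  have hd₁ := hf₁.hasDerivAt_of_isOpen hIopen hs
  have hd₂ := hf₂.hasDerivAt_of_isOpen hIopen hs
  have heq : deriv (deriv α) =ᶠ[nhds s] _ :=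
    Filter.eventuallyEq_of_mem (hIopen.mem_nhds hs) hα''
  have hc : HasDerivAt (fun t => -(ε * deriv (deriv f) t) / (2 * deriv f t ^ 2)) _ s :=
    (hd₂.const_mul ε).neg.div ((hd₁.pow 2).const_mul 2)
    (by simpa using hne)
  have hv : HasDerivAt
      (fun t => (ε / 2) • ((2, 2 * f t, 2 * f t) : ℝ × ℝ × ℝ)) _ s :=
    ((hasDerivAt_const s (2 : ℝ)).prodMk
    ((hd.const_mul 2).prodMk (hd.const_mul 2))).const_smul (ε / 2)
  have hε2 : ε ^ 2 = 1 := by rcases hε with rfl | rfl <;> norm_num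
  rw [heq.deriv_eq, ((hasDerivAt_smul_null_curve hc hd).fun_add hv).deriv]
  simp only [mg, Prod.fst_add, Prod.snd_add, Prod.smul_fst, Prod.smul_snd, smul_eq_mul,
    Pi.neg_apply]
  generalize f s = a, deriv f s = b, deriv (deriv f) s = c, deriv (deriv (deriv f)) s = d at *
  field_simp
  ring_nf
  simp only [hε2]
  ring
end
end

section
/- Let α : I → ℝ³ be a smooth curve in the 3-dimensional Minkowski spacetime on an open interval I, f : I → ℝ smooth with f(s) ≠ 0 and f'(s) ≠ 0 on I, ε ∈ {1, -1}, and α'(s) = (ε/(2 f'(s))) · (2 f(s), f(s)² − 1, f(s)² + 1) for all s ∈ I. Define L = α', W = α'', and N(s) = −(ε f''(s)²/(4 f'(s)³)) · (2 f(s), f(s)² − 1, f(s)² + 1) + (ε f''(s)/f'(s)) · (1, f(s), f(s)) − ε f'(s) · (0, 1, 1). Then along α: g(L, N) = 1, g(W, W) = 1, g(L, L) = 0, g(L, W) = 0, g(N, N) = 0 and g(N, W) = 0. -/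
open Real Set

noncomputable section

/-- Derivative of the null curve `(ε / 2f') • (2f, f² - 1, f² + 1)`. -/
lemma hasDerivAt_null_tangent {f p : ℝ → ℝ} {q s : ℝ} (ε : ℝ) (hf : HasDerivAt f (p s) s)
    (hp : HasDerivAt p q s) (h0 : p s ≠ 0) :
    HasDerivAt
      (fun t => (ε / (2 * p t)) • ((2 * f t, f t ^ 2 - 1, f t ^ 2 + 1) : ℝ × ℝ × ℝ))
      ((-(ε * q / (2 * p s ^ 2))) • ((2 * f s, f s ^ 2 - 1, f s ^ 2 + 1) : ℝ × ℝ × ℝ)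
        + ε • ((1, f s, f s) : ℝ × ℝ × ℝ)) s := by
  have hc : HasDerivAt (fun t => ε / (2 * p t)) (-(ε * q / (2 * p s ^ 2))) s := by
    refine ((hasDerivAt_const s ε).fun_div (hp.const_mul 2)
      (mul_ne_zero two_ne_zero h0)).congr_deriv ?_
    field_simp
    ring
  have hv : HasDerivAt (fun t => ((2 * f t, f t ^ 2 - 1, f t ^ 2 + 1) : ℝ × ℝ × ℝ))
      (2 * p s, 2 * f s * p s, 2 * f s * p s) s := by
    have h2 : HasDerivAt (fun t => f t ^ 2) (2 * f s * p s) s := by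
      simpa using hf.fun_pow 2
    exact (hf.const_mul 2).prodMk ((h2.sub_const 1).prodMk (h2.add_const 1))
  refine (hc.fun_smul hv).congr_deriv ?_
  ext <;> simp <;> field_simp <;> ring

theorem frenet_frame_products
    (I : Set ℝ) (hIopen : IsOpen I) (hIord : I.OrdConnected)
    (α : ℝ → ℝ × ℝ × ℝ) (hα : ContDiffOn ℝ (⊤ : ℕ∞) α I)
    (f : ℝ → ℝ) (hf : ContDiffOn ℝ (⊤ : ℕ∞) f I)
    (hf0 : ∀ s ∈ I, f s ≠ 0) (hf'0 : ∀ s ∈ I, deriv f s ≠ 0)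
    (ε : ℝ) (hε : ε = 1 ∨ ε = -1)
    (hα' : ∀ s ∈ I, deriv α s =
      (ε / (2 * deriv f s)) • ((2 * f s, f s ^ 2 - 1, f s ^ 2 + 1) : ℝ × ℝ × ℝ))
    (L W N : ℝ → ℝ × ℝ × ℝ)
    (hL : ∀ s, L s = deriv α s)
    (hW : ∀ s, W s = deriv (deriv α) s)
    (hN : ∀ s, N s =
      (-(ε * deriv (deriv f) s ^ 2 / (4 * deriv f s ^ 3))) •
          ((2 * f s, f s ^ 2 - 1, f s ^ 2 + 1) : ℝ × ℝ × ℝ)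
        + (ε * deriv (deriv f) s / deriv f s) • ((1, f s, f s) : ℝ × ℝ × ℝ)
        - (ε * deriv f s) • ((0, 1, 1) : ℝ × ℝ × ℝ)) :
    ∀ s ∈ I, mg (L s) (N s) = 1 ∧ mg (W s) (W s) = 1 ∧ mg (L s) (L s) = 0 ∧
      mg (L s) (W s) = 0 ∧ mg (N s) (N s) = 0 ∧ mg (N s) (W s) = 0 := by
  intro s hs
  have hI : I ∈ nhds s := hIopen.mem_nhds hs
  have hp : deriv f s ≠ 0 := hf'0 s hs
  have hfd : HasDerivAt f (deriv f s) s :=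
    ((hf.contDiffAt hI).differentiableAt (by simp)).hasDerivAt
  have hfdd : HasDerivAt (deriv f) (deriv (deriv f) s) s :=
    (((hf.deriv_of_isOpen (m := 1) hIopen (by norm_cast)).contDiffAt hI).differentiableAt
      (by simp)).hasDerivAt
  have hWs := hW s
  rw [((hasDerivAt_null_tangent ε hfd hfdd hp).congr_of_eventuallyEq
    (Filter.eventually_of_mem hI hα')).deriv] at hWs
  rw [hL s, hα' s hs, hWs, hN s]
  generalize deriv (deriv f) s = q at *
  generalize deriv f s = p at *
  generalize f s = x at *
  simp only [mg, Prod.smul_mk, Prod.mk_add_mk, Prod.mk_sub_mk, smul_eq_mul]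
  rcases hε with rfl | rfl <;> refine ⟨?_, ?_, ?_, ?_, ?_, ?_⟩ <;> field_simp <;> ring
end
end

section
/- Let α : I → ℝ³ be a smooth curve in the 3-dimensional Minkowski spacetime on an open interval I, f : I → ℝ smooth with f(s) ≠ 0 and f'(s) ≠ 0 on I, ε ∈ {1, -1}, and α'(s) = (ε/(2 f'(s))) · (2 f(s), f(s)² − 1, f(s)² + 1) for all s ∈ I. Define L = α', W = α'', N(s) = −(ε f''(s)²/(4 f'(s)³)) · (2 f(s), f(s)² − 1, f(s)² + 1) + (ε f''(s)/f'(s)) · (1, f(s), f(s)) − ε f'(s) · (0, 1, 1), and τ(s) = (f''(s)/f'(s))' − (1/2)(f''(s)/f'(s))². Then the Frenet equations hold: L' = W, N' = τ·W, and W' = −τ·L − N on I. -/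
open Real Set

noncomputable section

/-- Product rule for a combination of the moving vectors `(2f, f² - 1, f² + 1)`, `(1, f, f)` and
the constant vector `(0, 1, 1)`. -/
theorem hasDerivAt_null_combination {f a b c : ℝ → ℝ} {f' a' b' c' s : ℝ}
    (hf : HasDerivAt f f' s) (ha : HasDerivAt a a' s) (hb : HasDerivAt b b' s)
    (hc : HasDerivAt c c' s) :
    HasDerivAt (fun t => a t • ((2 * f t, f t ^ 2 - 1, f t ^ 2 + 1) : ℝ × ℝ × ℝ)
        + b t • ((1, f t, f t) : ℝ × ℝ × ℝ) + c t • ((0, 1, 1) : ℝ × ℝ × ℝ))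
      (a' • ((2 * f s, f s ^ 2 - 1, f s ^ 2 + 1) : ℝ × ℝ × ℝ)
        + (2 * a s * f' + b') • ((1, f s, f s) : ℝ × ℝ × ℝ)
        + (b s * f' + c') • ((0, 1, 1) : ℝ × ℝ × ℝ)) s := by
  have hV : HasDerivAt (fun t => ((2 * f t, f t ^ 2 - 1, f t ^ 2 + 1) : ℝ × ℝ × ℝ))
      (2 * f', 2 * f s * f', 2 * f s * f') s := by
    have hsq : HasDerivAt (fun t => f t ^ 2) (2 * f s * f') s := by simpa using hf.fun_pow 2
    exact (hf.const_mul 2).prodMk ((hsq.sub_const 1).prodMk (hsq.add_const 1))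
  have hU : HasDerivAt (fun t => ((1, f t, f t) : ℝ × ℝ × ℝ)) (0, f', f') s :=
    (hasDerivAt_const s 1).prodMk (hf.prodMk hf)
  refine (((ha.fun_smul hV).fun_add (hb.fun_smul hU)).fun_add
    (hc.smul_const ((0, 1, 1) : ℝ × ℝ × ℝ))).congr_deriv ?_
  ext <;> simp <;> ring

theorem frenet_equations_of_deriv_formula
    (I : Set ℝ) (hIopen : IsOpen I) (hIord : I.OrdConnected)
    (α : ℝ → ℝ × ℝ × ℝ) (hα : ContDiffOn ℝ (⊤ : ℕ∞) α I)
    (f : ℝ → ℝ) (hf : ContDiffOn ℝ (⊤ : ℕ∞) f I)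
    (hf0 : ∀ s ∈ I, f s ≠ 0) (hf'0 : ∀ s ∈ I, deriv f s ≠ 0)
    (ε : ℝ) (hε : ε = 1 ∨ ε = -1)
    (hα' : ∀ s ∈ I, deriv α s =
      (ε / (2 * deriv f s)) • ((2 * f s, f s ^ 2 - 1, f s ^ 2 + 1) : ℝ × ℝ × ℝ))
    (L W N : ℝ → ℝ × ℝ × ℝ)
    (hL : ∀ s, L s = deriv α s)
    (hW : ∀ s, W s = deriv (deriv α) s)
    (hN : ∀ s, N s =
      (-(ε * deriv (deriv f) s ^ 2 / (4 * deriv f s ^ 3))) •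
          ((2 * f s, f s ^ 2 - 1, f s ^ 2 + 1) : ℝ × ℝ × ℝ)
        + (ε * deriv (deriv f) s / deriv f s) • ((1, f s, f s) : ℝ × ℝ × ℝ)
        - (ε * deriv f s) • ((0, 1, 1) : ℝ × ℝ × ℝ))
    (τ : ℝ → ℝ)
    (hτ : ∀ s, τ s = deriv (fun t => deriv (deriv f) t / deriv f t) s
      - (1 / 2) * (deriv (deriv f) s / deriv f s) ^ 2) :
    ∀ s ∈ I, deriv L s = W s ∧ deriv N s = τ s • W s ∧
      deriv W s = -(τ s) • L s - N s := by
  intro s hs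
  have hdf : ContDiffOn ℝ (⊤ : ℕ∞) (deriv f) I := hf.deriv_of_isOpen hIopen (by simp)
  have hddf : ContDiffOn ℝ (⊤ : ℕ∞) (deriv (deriv f)) I := hdf.deriv_of_isOpen hIopen (by simp)
  have hasDeriv {g : ℝ → ℝ} (hg : ContDiffOn ℝ (⊤ : ℕ∞) g I) {t : ℝ} (ht : t ∈ I) :
      HasDerivAt g (deriv g t) t :=
    ((hg.differentiableOn (by simp)).differentiableAt (hIopen.mem_nhds ht)).hasDerivAt
  have hL_eq : L = deriv α := funext hL
  have hW_eq : W = deriv (deriv α) := funext hW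
  have hW_formula : ∀ t ∈ I, W t =
      (-(ε * deriv (deriv f) t / (2 * deriv f t ^ 2))) •
          ((2 * f t, f t ^ 2 - 1, f t ^ 2 + 1) : ℝ × ℝ × ℝ)
        + ε • ((1, f t, f t) : ℝ × ℝ × ℝ) + (0 : ℝ) • ((0, 1, 1) : ℝ × ℝ × ℝ) := by
    intro t ht
    have h0 := hf'0 t ht
    have hcoef := (hasDerivAt_const t ε).fun_div ((hasDeriv hdf ht).const_mul 2)
      (mul_ne_zero two_ne_zero h0)
    have hder := hasDerivAt_null_combination (hasDeriv hf ht) hcoef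
      (hasDerivAt_const t 0) (hasDerivAt_const t 0)
    rw [hW, (hder.congr_of_eventuallyEq ?_).deriv]
    · congr 3 <;> field_simp <;> ring
    · filter_upwards [hIopen.mem_nhds ht] with u hu
      simp [hα' u hu]
  have h0 := hf'0 s hs
  have h1 := hasDeriv hf hs
  have h2 := hasDeriv hdf hs
  have h3 := hasDeriv hddf hs
  have hτs : τ s = deriv (deriv (deriv f)) s / deriv f s
      - 3 / 2 * (deriv (deriv f) s / deriv f s) ^ 2 := by
    rw [hτ, (h3.fun_div h2 h0).deriv]
    field_simp
    ring
  refine ⟨by rw [hL_eq, hW_eq], ?_, ?_⟩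
  · have hN_eq : N = fun t =>
        (-(ε * deriv (deriv f) t ^ 2 / (4 * deriv f t ^ 3))) •
            ((2 * f t, f t ^ 2 - 1, f t ^ 2 + 1) : ℝ × ℝ × ℝ)
          + (ε * deriv (deriv f) t / deriv f t) • ((1, f t, f t) : ℝ × ℝ × ℝ)
          + (-(ε * deriv f t)) • ((0, 1, 1) : ℝ × ℝ × ℝ) := by
      funext t
      rw [hN, neg_smul (ε * deriv f t), ← sub_eq_add_neg]
    have ha := (((h3.fun_pow 2).const_mul ε).fun_div ((h2.fun_pow 3).const_mul 4)
      (mul_ne_zero four_ne_zero (pow_ne_zero 3 h0))).fun_neg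
    have hb := (h3.const_mul ε).fun_div h2 h0
    have hc := (h2.const_mul ε).fun_neg
    rw [hN_eq, (hasDerivAt_null_combination h1 ha hb hc).deriv, hW_formula s hs, hτs]
    ext <;> simp <;> field_simp <;> ring
  · have ha := ((h3.const_mul ε).fun_div ((h2.fun_pow 2).const_mul 2)
      (mul_ne_zero two_ne_zero (pow_ne_zero 2 h0))).fun_neg
    have hder := hasDerivAt_null_combination h1 ha (hasDerivAt_const s ε) (hasDerivAt_const s 0)
    rw [(hder.congr_of_eventuallyEq
      (Filter.eventually_of_mem (hIopen.mem_nhds hs) hW_formula)).deriv, hL, hα' s hs, hN, hτs]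
    ext <;> simp <;> field_simp <;> ring
end
end

section
/- Let α : I → ℝ³ be a smooth curve in the 3-dimensional Minkowski spacetime on an open interval I, f : I → ℝ smooth with f(s) ≠ 0 and f'(s) ≠ 0 on I, ε ∈ {1, -1}, and α'(s) = (ε/(2 f'(s))) · (2 f(s), f(s)² − 1, f(s)² + 1) for all s ∈ I. Define L = α', W = α'', and N(s) = −(ε f''(s)²/(4 f'(s)³)) · (2 f(s), f(s)² − 1, f(s)² + 1) + (ε f''(s)/f'(s)) · (1, f(s), f(s)) − ε f'(s) · (0, 1, 1). Then for every s ∈ I the determinant of the 3×3 matrix with columns L(s), N(s), W(s) equals ε. -/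
open Real Set

noncomputable section

theorem det_frenet_frame_eq_eps
    (I : Set ℝ) (hIopen : IsOpen I) (hIord : I.OrdConnected)
    (α : ℝ → ℝ × ℝ × ℝ) (hα : ContDiffOn ℝ (⊤ : ℕ∞) α I)
    (f : ℝ → ℝ) (hf : ContDiffOn ℝ (⊤ : ℕ∞) f I)
    (hf0 : ∀ s ∈ I, f s ≠ 0) (hf'0 : ∀ s ∈ I, deriv f s ≠ 0)
    (ε : ℝ) (hε : ε = 1 ∨ ε = -1)
    (hα' : ∀ s ∈ I, deriv α s =
      (ε / (2 * deriv f s)) • ((2 * f s, f s ^ 2 - 1, f s ^ 2 + 1) : ℝ × ℝ × ℝ))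
    (L W N : ℝ → ℝ × ℝ × ℝ)
    (hL : ∀ s, L s = deriv α s)
    (hW : ∀ s, W s = deriv (deriv α) s)
    (hN : ∀ s, N s =
      (-(ε * deriv (deriv f) s ^ 2 / (4 * deriv f s ^ 3))) •
          ((2 * f s, f s ^ 2 - 1, f s ^ 2 + 1) : ℝ × ℝ × ℝ)
        + (ε * deriv (deriv f) s / deriv f s) • ((1, f s, f s) : ℝ × ℝ × ℝ)
        - (ε * deriv f s) • ((0, 1, 1) : ℝ × ℝ × ℝ)) :
    ∀ s ∈ I,
      Matrix.det !![(L s).1, (N s).1, (W s).1;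
                    (L s).2.1, (N s).2.1, (W s).2.1;
                    (L s).2.2, (N s).2.2, (W s).2.2] = ε := by
  intro s hs
  have hfI : ContDiffAt ℝ (⊤ : ℕ∞) f s := hf.contDiffAt (hIopen.mem_nhds hs)
  have hdf : HasDerivAt f (deriv f s) s :=
    (hfI.differentiableAt (by simp)).hasDerivAt
  have hddf : HasDerivAt (deriv f) (deriv (deriv f) s) s := by
    have h : ContDiffOn ℝ 1 (deriv f) I :=
      hf.deriv_of_isOpen hIopen (by norm_cast)
    exact ((h.contDiffAt (hIopen.mem_nhds hs)).differentiableAt (by simp)).hasDerivAt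
  have hne : deriv f s ≠ 0 := hf'0 s hs
  have hscale : HasDerivAt (fun t => ε / (2 * deriv f t))
      (-(ε * deriv (deriv f) s) / (2 * deriv f s ^ 2)) s := by
    refine ((hasDerivAt_const s ε).fun_div (hddf.const_mul 2)
      (mul_ne_zero two_ne_zero hne)).congr_deriv ?_
    field_simp
    ring
  have hnull : HasDerivAt
      (fun t => ((2 * f t, f t ^ 2 - 1, f t ^ 2 + 1) : ℝ × ℝ × ℝ))
      (2 * deriv f s, 2 * f s * deriv f s, 2 * f s * deriv f s) s := by
    have hsq : HasDerivAt (fun t => f t ^ 2) (2 * f s * deriv f s) s := by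
      simpa using hdf.fun_pow 2
    exact (hdf.const_mul 2).prodMk ((hsq.sub_const 1).prodMk (hsq.add_const 1))
  have hWs : W s = _ := (hW s).trans <|
    ((hscale.smul hnull).congr_of_eventuallyEq
      (Filter.eventuallyEq_of_mem (hIopen.mem_nhds hs) hα')).deriv
  have hε2 : ε ^ 2 = 1 := by rcases hε with rfl | rfl <;> norm_num
  rw [hWs, hN s, hL s, hα' s hs, Matrix.det_fin_three]
  simp only [Matrix.of_apply, Matrix.cons_val, Prod.fst_add, Prod.snd_add, Prod.fst_sub,
    Prod.snd_sub, Prod.smul_fst, Prod.smul_snd, smul_eq_mul]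
  field_simp
  linear_combination 16 * ε * deriv f s ^ 6 * hε2
end
end

section
/- Let a be a nonzero real constant and let L, N, W : (0, ∞) → ℝ³ be smooth vector fields satisfying g(L, N) = 1, g(W, W) = 1, g(L, L) = g(L, W) = g(N, N) = g(N, W) = 0, and the Frenet equations L' = W, N' = τ·W, W' = −τ·L − N with τ(s) = a/(2s²). Then the vector field V(s) = −(a/(2s))·L(s) + s·N(s) + W(s) is constant (V' = 0 on (0, ∞)) and satisfies g(W(s), V(s)) = 1 for all s > 0. -/
open Real Set

noncomputable section

lemma mg_add_right (u v w : ℝ × ℝ × ℝ) : mg u (v + w) = mg u v + mg u w := by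
  simp only [mg, Prod.fst_add, Prod.snd_add]
  ring

lemma mg_smul_right (c : ℝ) (u v : ℝ × ℝ × ℝ) : mg u (c • v) = c * mg u v := by
  simp only [mg, Prod.smul_fst, Prod.smul_snd, smul_eq_mul]
  ring

lemma mg_comm (u v : ℝ × ℝ × ℝ) : mg u v = mg v u := by
  simp only [mg]
  ring

lemma ContDiffOn.hasDerivAt_of_Ioi {E : Type*} [NormedAddCommGroup E] [NormedSpace ℝ E]
    {f : ℝ → E} {c s : ℝ} (hf : ContDiffOn ℝ (⊤ : ℕ∞) f (Ioi c)) (hs : s ∈ Ioi c) :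
    HasDerivAt f (deriv f s) s :=
  ((hf.contDiffAt (Ioi_mem_nhds hs)).differentiableAt (by simp)).hasDerivAt

theorem slant_helix_axis_vector
    (a : ℝ) (ha : a ≠ 0)
    (L N W : ℝ → ℝ × ℝ × ℝ)
    (hLsmooth : ContDiffOn ℝ (⊤ : ℕ∞) L (Ioi 0))
    (hNsmooth : ContDiffOn ℝ (⊤ : ℕ∞) N (Ioi 0))
    (hWsmooth : ContDiffOn ℝ (⊤ : ℕ∞) W (Ioi 0))
    (hLN : ∀ s ∈ Ioi (0 : ℝ), mg (L s) (N s) = 1)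
    (hWW : ∀ s ∈ Ioi (0 : ℝ), mg (W s) (W s) = 1)
    (hLL : ∀ s ∈ Ioi (0 : ℝ), mg (L s) (L s) = 0)
    (hLW : ∀ s ∈ Ioi (0 : ℝ), mg (L s) (W s) = 0)
    (hNN : ∀ s ∈ Ioi (0 : ℝ), mg (N s) (N s) = 0)
    (hNW : ∀ s ∈ Ioi (0 : ℝ), mg (N s) (W s) = 0)
    (hL' : ∀ s ∈ Ioi (0 : ℝ), deriv L s = W s)
    (hN' : ∀ s ∈ Ioi (0 : ℝ), deriv N s = (a / (2 * s ^ 2)) • W s)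
    (hW' : ∀ s ∈ Ioi (0 : ℝ), deriv W s = (-(a / (2 * s ^ 2))) • L s - N s)
    (V : ℝ → ℝ × ℝ × ℝ)
    (hV : ∀ s, V s = (-(a / (2 * s))) • L s + s • N s + W s) :
    (∀ s ∈ Ioi (0 : ℝ), deriv V s = 0) ∧
    (∀ s ∈ Ioi (0 : ℝ), mg (W s) (V s) = 1) := by
  refine ⟨fun s hs => ?_, fun s hs => ?_⟩
  · have hs0 : s ≠ 0 := ne_of_gt hs
    have hL := hLsmooth.hasDerivAt_of_Ioi hs
    have hN := hNsmooth.hasDerivAt_of_Ioi hs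
    have hW := hWsmooth.hasDerivAt_of_Ioi hs
    rw [hL' s hs] at hL
    rw [hN' s hs] at hN
    rw [hW' s hs] at hW
    have hc : HasDerivAt (fun t : ℝ => -(a / (2 * t))) (a / (2 * s ^ 2)) s := by
      have hinv := (hasDerivAt_inv hs0).const_mul (-(a / 2))
      have hfun : (fun t : ℝ => -(a / (2 * t))) = fun t => -(a / 2) * t⁻¹ := by
        funext t
        simp only [div_eq_mul_inv, mul_inv]
        ring
      have hval : a / (2 * s ^ 2) = -(a / 2) * -(s ^ 2)⁻¹ := by field_simp
      rw [hfun, hval]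
      exact hinv
    have hVeq : V = fun t => (-(a / (2 * t))) • L t + t • N t + W t := funext hV
    rw [hVeq]
    refine (((hc.smul hL).add ((hasDerivAt_id s).smul hN)).add hW).deriv.trans ?_
    simp only [id]
    match_scalars <;> field_simp <;> ring
  · rw [hV, mg_add_right, mg_add_right, mg_smul_right, mg_smul_right, mg_comm (W s) (L s),
      mg_comm (W s) (N s), hLW s hs, hNW s hs, hWW s hs]
    ring
end
end

section
/- The curve α : (0, ∞) → ℝ³ given by α(s) = (s²/8)·(2(2 ln s − 1), 2 (ln s)² − 2 ln s − 1, 2 (ln s)² − 2 ln s + 3) in the 3-dimensional Minkowski spacetime is null, is parametrized by pseudo-arc (g(α', α') = 0 and g(α'', α'') = 1), and its torsion satisfies (1/2) g(α'''(s), α'''(s)) = 1/(2s²) for all s > 0. -/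
open Real Set

noncomputable section

/-- If `f` agrees on `(0, ∞)` with a curve `c` having derivative `c'` there, then so does `deriv f`
with `c'`. -/
theorem deriv_eq_of_hasDerivAt_Ioi {E : Type*} [NormedAddCommGroup E] [NormedSpace ℝ E]
    {f c c' : ℝ → E} (hf : ∀ s ∈ Ioi (0 : ℝ), f s = c s)
    (hc : ∀ s ∈ Ioi (0 : ℝ), HasDerivAt c (c' s) s) :
    ∀ s ∈ Ioi (0 : ℝ), deriv f s = c' s := fun s hs =>
  ((hc s hs).congr_of_eventuallyEq
    (Filter.eventually_of_mem (Ioi_mem_nhds hs) hf)).deriv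

theorem slant_helix_a_eq_one
    (α : ℝ → ℝ × ℝ × ℝ)
    (hα : ∀ s, α s = (s ^ 2 / 8) •
      ((2 * (2 * Real.log s - 1),
        2 * (Real.log s) ^ 2 - 2 * Real.log s - 1,
        2 * (Real.log s) ^ 2 - 2 * Real.log s + 3) : ℝ × ℝ × ℝ)) :
    ∀ s ∈ Ioi (0 : ℝ), mg (deriv α s) (deriv α s) = 0 ∧
      mg (deriv (deriv α) s) (deriv (deriv α) s) = 1 ∧
      (1 / 2) * mg (deriv (deriv (deriv α)) s) (deriv (deriv (deriv α)) s)
        = 1 / (2 * s ^ 2) := by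
  have h₁ : ∀ s ∈ Ioi (0 : ℝ), deriv α s = (s * log s, s / 2 * (log s ^ 2 - 1),
      s / 2 * (log s ^ 2 + 1)) := by
    refine deriv_eq_of_hasDerivAt_Ioi (c := fun s => (s ^ 2 / 8 * (2 * (2 * log s - 1)),
      s ^ 2 / 8 * (2 * log s ^ 2 - 2 * log s - 1), s ^ 2 / 8 * (2 * log s ^ 2 - 2 * log s + 3)))
      (fun s _ => hα s) fun s hs => ?_
    have hs0 : s ≠ 0 := (mem_Ioi.mp hs).ne'
    have hl := hasDerivAt_log hs0
    have hq := (hasDerivAt_pow 2 s).div_const 8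
    have hp := ((hl.pow 2).const_mul 2).sub (hl.const_mul 2)
    refine HasDerivAt.prodMk ?_ (HasDerivAt.prodMk ?_ ?_)
    · refine HasDerivAt.congr_deriv (hq.mul (((hl.const_mul 2).sub_const 1).const_mul 2)) ?_
      simp; field_simp; ring
    · refine HasDerivAt.congr_deriv (hq.mul (hp.sub_const 1)) ?_
      simp; field_simp; ring
    · refine HasDerivAt.congr_deriv (hq.mul (hp.add_const 3)) ?_
      simp; field_simp; ring
  have h₂ : ∀ s ∈ Ioi (0 : ℝ), deriv (deriv α) s = (log s + 1, (log s ^ 2 - 1) / 2 + log s,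
      (log s ^ 2 + 1) / 2 + log s) := by
    refine deriv_eq_of_hasDerivAt_Ioi h₁ fun s hs => ?_
    have hs0 : s ≠ 0 := (mem_Ioi.mp hs).ne'
    have hl := hasDerivAt_log hs0
    have hq := (hasDerivAt_id s).div_const 2
    refine HasDerivAt.prodMk ?_ (HasDerivAt.prodMk ?_ ?_)
    · refine HasDerivAt.congr_deriv ((hasDerivAt_id s).mul hl) ?_
      simp; field_simp
    · refine HasDerivAt.congr_deriv (hq.mul ((hl.pow 2).sub_const 1)) ?_
      simp; field_simp
    · refine HasDerivAt.congr_deriv (hq.mul ((hl.pow 2).add_const 1)) ?_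
      simp; field_simp
  have h₃ : ∀ s ∈ Ioi (0 : ℝ), deriv (deriv (deriv α)) s = (1 / s, (log s + 1) / s,
      (log s + 1) / s) := by
    refine deriv_eq_of_hasDerivAt_Ioi h₂ fun s hs => ?_
    have hs0 : s ≠ 0 := (mem_Ioi.mp hs).ne'
    have hl := hasDerivAt_log hs0
    refine HasDerivAt.prodMk ?_ (HasDerivAt.prodMk ?_ ?_)
    · refine HasDerivAt.congr_deriv (hl.add_const 1) ?_
      simp
    · refine HasDerivAt.congr_deriv ((((hl.pow 2).sub_const 1).div_const 2).add hl) ?_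
      simp; field_simp
    · refine HasDerivAt.congr_deriv ((((hl.pow 2).add_const 1).div_const 2).add hl) ?_
      simp; field_simp
  intro s hs
  have hs0 : s ≠ 0 := (mem_Ioi.mp hs).ne'
  rw [h₁ s hs, h₂ s hs, h₃ s hs]
  simp only [mg]
  refine ⟨by ring, by ring, ?_⟩
  field_simp
  ring
end
end

section
/- Let a > 1 and b = √(a − 1). The curve α : (0, ∞) → ℝ³ given by α(s) = (s²/b)·( (2 sin(b ln s) − b cos(b ln s))/(b² + 4), −(2 cos(b ln s) + b sin(b ln s))/(b² + 4), 1/2 ) in the 3-dimensional Minkowski spacetime is null, is parametrized by pseudo-arc (g(α', α') = 0 and g(α'', α'') = 1), and its torsion satisfies (1/2) g(α'''(s), α'''(s)) = a/(2s²) = (1 + b²)/(2s²) for all s > 0. -/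
open Real Set

noncomputable section

theorem HasDerivAt.sin_mul_log (b : ℝ) {s : ℝ} (hs : s ≠ 0) :
    HasDerivAt (fun t => Real.sin (b * Real.log t)) (Real.cos (b * Real.log s) * (b / s)) s := by
  simpa [div_eq_mul_inv] using ((Real.hasDerivAt_log hs).const_mul b).sin

theorem HasDerivAt.cos_mul_log (b : ℝ) {s : ℝ} (hs : s ≠ 0) :
    HasDerivAt (fun t => Real.cos (b * Real.log t)) (-Real.sin (b * Real.log s) * (b / s)) s := by
  simpa [div_eq_mul_inv] using ((Real.hasDerivAt_log hs).const_mul b).cos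

theorem deriv_eq_of_eqOn_Ioi {E : Type*} [NormedAddCommGroup E] [NormedSpace ℝ E]
    {f g : ℝ → E} {g' : E} {c s : ℝ} (hs : c < s) (hfg : ∀ t, c < t → f t = g t)
    (hg : HasDerivAt g g' s) : deriv f s = g' :=
  (hg.congr_of_eventuallyEq
    (Filter.eventually_of_mem (Ioi_mem_nhds hs) fun t ht => hfg t ht)).deriv

theorem slant_helix_a_gt_one
    (a b : ℝ) (ha : 1 < a) (hb : b = Real.sqrt (a - 1))
    (α : ℝ → ℝ × ℝ × ℝ)
    (hα : ∀ s, α s = (s ^ 2 / b) •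
      (((2 * Real.sin (b * Real.log s) - b * Real.cos (b * Real.log s)) / (b ^ 2 + 4),
        -((2 * Real.cos (b * Real.log s) + b * Real.sin (b * Real.log s)) / (b ^ 2 + 4)),
        1 / 2) : ℝ × ℝ × ℝ)) :
    ∀ s ∈ Ioi (0 : ℝ), mg (deriv α s) (deriv α s) = 0 ∧
      mg (deriv (deriv α) s) (deriv (deriv α) s) = 1 ∧
      (1 / 2) * mg (deriv (deriv (deriv α)) s) (deriv (deriv (deriv α)) s)
        = a / (2 * s ^ 2) ∧
      a / (2 * s ^ 2) = (1 + b ^ 2) / (2 * s ^ 2) := by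
  have hb0 : b ≠ 0 := by
    rw [hb]; exact (Real.sqrt_pos.mpr (by linarith)).ne'
  have hab : a = 1 + b ^ 2 := by
    rw [hb, Real.sq_sqrt (by linarith)]; ring
  have hD : b ^ 2 + 4 ≠ 0 := by positivity
  have h₁ : ∀ s : ℝ, 0 < s → deriv α s =
      (s * Real.sin (b * Real.log s) / b, -(s * Real.cos (b * Real.log s) / b), s / b) := by
    intro s hs
    have hs0 := hs.ne'
    have hsin := HasDerivAt.sin_mul_log b hs0
    have hcos := HasDerivAt.cos_mul_log b hs0
    have hsq := ((hasDerivAt_id' s).pow 2).div_const b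
    refine deriv_eq_of_eqOn_Ioi hs (fun t _ => hα t) ?_
    refine (hsq.smul ((((hsin.const_mul 2).sub (hcos.const_mul b)).div_const (b ^ 2 + 4)).prodMk
      ((((hcos.const_mul 2).add (hsin.const_mul b)).div_const (b ^ 2 + 4)).neg.prodMk
        (hasDerivAt_const s (1 / 2 : ℝ))))).congr_deriv ?_
    ext <;> simp <;> field_simp <;> ring
  have h₂ : ∀ s : ℝ, 0 < s → deriv (deriv α) s =
      ((Real.sin (b * Real.log s) + b * Real.cos (b * Real.log s)) / b,
        -((Real.cos (b * Real.log s) - b * Real.sin (b * Real.log s)) / b), 1 / b) := by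
    intro s hs
    have hs0 := hs.ne'
    have hid := hasDerivAt_id' s
    refine deriv_eq_of_eqOn_Ioi hs h₁ ?_
    refine (((hid.mul (HasDerivAt.sin_mul_log b hs0)).div_const b).prodMk
      (((hid.mul (HasDerivAt.cos_mul_log b hs0)).div_const b).neg.prodMk
        (hid.div_const b))).congr_deriv ?_
    ext <;> simp <;> field_simp <;> ring
  have h₃ : ∀ s : ℝ, 0 < s → deriv (deriv (deriv α)) s =
      ((Real.cos (b * Real.log s) - b * Real.sin (b * Real.log s)) / s,
        (Real.sin (b * Real.log s) + b * Real.cos (b * Real.log s)) / s, 0) := by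
    intro s hs
    have hs0 := hs.ne'
    have hsin := HasDerivAt.sin_mul_log b hs0
    have hcos := HasDerivAt.cos_mul_log b hs0
    refine deriv_eq_of_eqOn_Ioi hs h₂ ?_
    refine (((hsin.add (hcos.const_mul b)).div_const b).prodMk
      (((hcos.sub (hsin.const_mul b)).div_const b).neg.prodMk
        (hasDerivAt_const s (1 / b)))).congr_deriv ?_
    ext <;> simp <;> field_simp <;> ring
  intro s hs
  have hs0 : s ≠ 0 := (mem_Ioi.mp hs).ne'
  have hcs := Real.sin_sq_add_cos_sq (b * Real.log s)
  rw [h₁ s hs, h₂ s hs, h₃ s hs, hab]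
  simp only [mg]
  generalize Real.sin (b * Real.log s) = x at *
  generalize Real.cos (b * Real.log s) = y at *
  refine ⟨?_, ?_, ?_, trivial⟩
  · field_simp
    linear_combination s ^ 2 * hcs
  · field_simp
    linear_combination (1 + b ^ 2) * hcs
  · field_simp
    linear_combination (1 + b ^ 2) * hcs
end
end

section
/- Let a be a real constant with a < 1, a ≠ 0 and a ≠ −3, and set b = √(1 − a), so that b > 0, b ≠ 1 and b ≠ 2. The curve α : (0, ∞) → ℝ³ given by α(s) = (s²/(2b))·( −1, s^{−b}/(b − 2) + s^{b}/(b + 2), s^{−b}/(b − 2) − s^{b}/(b + 2) ) in the 3-dimensional Minkowski spacetime is null, is parametrized by pseudo-arc (g(α', α') = 0 and g(α'', α'') = 1), and its torsion satisfies (1/2) g(α'''(s), α'''(s)) = a/(2s²) = (1 − b²)/(2s²) for all s > 0. -/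
open Real Set

noncomputable section

/-- The curve `s ↦ (x sᵖ, y s^q + z sʳ, y s^q - z sʳ)`. -/
def powerCurve (x y z p q r s : ℝ) : ℝ × ℝ × ℝ :=
  (x * s ^ p, y * s ^ q + z * s ^ r, y * s ^ q - z * s ^ r)

theorem hasDerivAt_powerCurve (x y z p q r : ℝ) {s : ℝ} (hs : 0 < s) :
    HasDerivAt (powerCurve x y z p q r)
      (powerCurve (x * p) (y * q) (z * r) (p - 1) (q - 1) (r - 1) s) s := by
  have key (c t : ℝ) : HasDerivAt (fun u : ℝ => c * u ^ t) (c * t * s ^ (t - 1)) s := by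
    simpa only [mul_assoc] using (Real.hasDerivAt_rpow_const (p := t) (Or.inl hs.ne')).const_mul c
  exact (key x p).prodMk (((key y q).add (key z r)).prodMk ((key y q).sub (key z r)))

theorem deriv_eqOn_powerCurve {f : ℝ → ℝ × ℝ × ℝ} {x y z p q r : ℝ}
    (hf : EqOn f (powerCurve x y z p q r) (Ioi 0)) :
    EqOn (deriv f) (powerCurve (x * p) (y * q) (z * r) (p - 1) (q - 1) (r - 1)) (Ioi 0) :=
  fun _ hs => ((hasDerivAt_powerCurve x y z p q r hs).congr_of_eventuallyEq
    (hf.eventuallyEq_of_mem (Ioi_mem_nhds hs))).deriv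

theorem mg_powerCurve (x y z p q r : ℝ) {s : ℝ} (hs : 0 < s) (h : q + r = 2 * p) :
    mg (powerCurve x y z p q r s) (powerCurve x y z p q r s)
      = (x ^ 2 + 4 * y * z) * s ^ (2 * p) := by
  have hp : s ^ (2 * p) = s ^ p * s ^ p := by rw [two_mul, Real.rpow_add hs]
  have hqr : s ^ (2 * p) = s ^ q * s ^ r := by rw [← h, Real.rpow_add hs]
  simp only [mg, powerCurve]
  linear_combination -x ^ 2 * hp - 4 * y * z * hqr

theorem slant_helix_a_lt_one
    (a b : ℝ) (ha1 : a < 1) (ha0 : a ≠ 0) (ha3 : a ≠ -3)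
    (hb : b = Real.sqrt (1 - a))
    (α : ℝ → ℝ × ℝ × ℝ)
    (hα : ∀ s, α s = (s ^ 2 / (2 * b)) •
      ((-1,
        s ^ (-b) / (b - 2) + s ^ b / (b + 2),
        s ^ (-b) / (b - 2) - s ^ b / (b + 2)) : ℝ × ℝ × ℝ)) :
    0 < b ∧ b ≠ 1 ∧ b ≠ 2 ∧
    ∀ s ∈ Ioi (0 : ℝ), mg (deriv α s) (deriv α s) = 0 ∧
      mg (deriv (deriv α) s) (deriv (deriv α) s) = 1 ∧
      (1 / 2) * mg (deriv (deriv (deriv α)) s) (deriv (deriv (deriv α)) s)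
        = a / (2 * s ^ 2) ∧
      a / (2 * s ^ 2) = (1 - b ^ 2) / (2 * s ^ 2) := by
  have hb0 : 0 < b := hb ▸ Real.sqrt_pos.mpr (by linarith)
  have hbsq : b ^ 2 = 1 - a := by rw [hb, Real.sq_sqrt (by linarith)]
  have hb2 : b ≠ 2 := by
    rintro rfl
    exact ha3 (by linarith)
  refine ⟨hb0, ?_, hb2, fun s hs => ?_⟩
  · rintro rfl
    exact ha0 (by linarith)
  have hs0 : 0 < s := hs
  have hbm : b - 2 ≠ 0 := sub_ne_zero.mpr hb2
  have hbp : b + 2 ≠ 0 := by positivity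
  have h0 : EqOn α (powerCurve (-1 / (2 * b)) (1 / (2 * b * (b - 2))) (1 / (2 * b * (b + 2)))
      2 (2 - b) (2 + b)) (Ioi 0) := by
    intro u hu
    have hu0 : 0 < u := hu
    rw [hα, powerCurve, sub_eq_add_neg 2 b, Real.rpow_add hu0, Real.rpow_add hu0, Real.rpow_two]
    simp only [Prod.smul_mk, smul_eq_mul, Prod.mk.injEq]
    refine ⟨?_, ?_, ?_⟩ <;> field_simp
  have h1 := deriv_eqOn_powerCurve h0
  have h2 := deriv_eqOn_powerCurve h1
  have h3 := deriv_eqOn_powerCurve h2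
  have ha : a = 1 - b ^ 2 := by linarith
  rw [h1 hs, h2 hs, h3 hs, mg_powerCurve _ _ _ _ _ _ hs0 (by ring),
    mg_powerCurve _ _ _ _ _ _ hs0 (by ring), mg_powerCurve _ _ _ _ _ _ hs0 (by ring)]
  refine ⟨?_, ?_, ?_, by rw [ha]⟩
  · refine mul_eq_zero_of_left ?_ _
    field_simp
    ring
  · rw [show (2 : ℝ) * (2 - 1 - 1) = 0 by norm_num, Real.rpow_zero, mul_one]
    field_simp
    ring
  · rw [show (2 : ℝ) * (2 - 1 - 1 - 1) = -2 by norm_num, Real.rpow_neg hs0.le, Real.rpow_two, ha]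
    field_simp
    ring
end
end

section
/- The curve α : (0, ∞) → ℝ³ given by α(s) = (1/16)·(−4s², s⁴ − 4 ln s, −s⁴ − 4 ln s) in the 3-dimensional Minkowski spacetime is null, is parametrized by pseudo-arc (g(α', α') = 0 and g(α'', α'') = 1), and its torsion satisfies (1/2) g(α'''(s), α'''(s)) = −3/(2s²) for all s > 0. -/
open Real Set

noncomputable section

/-- The derivative of a curve in ℝ³ given coordinatewise on the positive half-line. -/
theorem deriv_eq_of_eqOn_Ioi_s18 {f : ℝ → ℝ × ℝ × ℝ} {x y z : ℝ → ℝ} {x' y' z' s : ℝ}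
    (hf : ∀ t ∈ Ioi (0 : ℝ), f t = (x t, y t, z t)) (hs : s ∈ Ioi (0 : ℝ))
    (hx : HasDerivAt x x' s) (hy : HasDerivAt y y' s) (hz : HasDerivAt z z' s) :
    deriv f s = (x', y', z') :=
  ((hx.prodMk (hy.prodMk hz)).congr_of_eventuallyEq
    (Filter.eventually_of_mem (Ioi_mem_nhds hs) hf)).deriv

theorem slant_helix_a_eq_neg_three
    (α : ℝ → ℝ × ℝ × ℝ)
    (hα : ∀ s, α s = (1 / 16 : ℝ) •
      ((-(4 * s ^ 2), s ^ 4 - 4 * Real.log s, -(s ^ 4) - 4 * Real.log s) : ℝ × ℝ × ℝ)) :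
    ∀ s ∈ Ioi (0 : ℝ), mg (deriv α s) (deriv α s) = 0 ∧
      mg (deriv (deriv α) s) (deriv (deriv α) s) = 1 ∧
      (1 / 2) * mg (deriv (deriv (deriv α)) s) (deriv (deriv (deriv α)) s)
        = -3 / (2 * s ^ 2) := by
  have h1 : ∀ s ∈ Ioi (0 : ℝ), deriv α s =
      (-(s / 2), (s ^ 3 - s⁻¹) / 4, (-s ^ 3 - s⁻¹) / 4) := by
    intro s hs
    have hlog := (Real.hasDerivAt_log ((mem_Ioi.1 hs).ne')).const_mul 4
    have h4 := hasDerivAt_pow 4 s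
    refine deriv_eq_of_eqOn_Ioi_s18 (fun t _ => hα t) hs ?_ ?_ ?_
    · refine HasDerivAt.congr_deriv ((((hasDerivAt_pow 2 s).const_mul 4).neg).const_mul (1 / 16 : ℝ)) ?_
      norm_num; ring
    · refine HasDerivAt.congr_deriv ((h4.sub hlog).const_mul (1 / 16 : ℝ)) ?_
      norm_num; ring
    · refine HasDerivAt.congr_deriv ((h4.neg.sub hlog).const_mul (1 / 16 : ℝ)) ?_
      norm_num; ring
  have h2 : ∀ s ∈ Ioi (0 : ℝ), deriv (deriv α) s =
      (-(1 / 2), (3 * s ^ 2 + (s ^ 2)⁻¹) / 4, (-(3 * s ^ 2) + (s ^ 2)⁻¹) / 4) := by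
    intro s hs
    have hinv := hasDerivAt_inv ((mem_Ioi.1 hs).ne')
    have h3 := hasDerivAt_pow 3 s
    refine deriv_eq_of_eqOn_Ioi_s18 h1 hs ?_ ?_ ?_
    · exact ((hasDerivAt_id s).div_const 2).neg
    · refine HasDerivAt.congr_deriv ((h3.sub hinv).div_const 4) ?_
      norm_num
    · refine HasDerivAt.congr_deriv ((h3.neg.sub hinv).div_const 4) ?_
      norm_num
  have h3 : ∀ s ∈ Ioi (0 : ℝ), deriv (deriv (deriv α)) s =
      (0, (6 * s - 2 * (s ^ 3)⁻¹) / 4, (-(6 * s) - 2 * (s ^ 3)⁻¹) / 4) := by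
    intro s hs
    have hs0 : s ≠ 0 := (mem_Ioi.1 hs).ne'
    have hsq := hasDerivAt_pow 2 s
    have hinv := hsq.fun_inv (pow_ne_zero 2 hs0)
    refine deriv_eq_of_eqOn_Ioi_s18 h2 hs (hasDerivAt_const s _) ?_ ?_
    · refine HasDerivAt.congr_deriv (((hsq.const_mul 3).add hinv).div_const 4) ?_
      norm_num; field_simp; ring
    · refine HasDerivAt.congr_deriv (((hsq.const_mul 3).neg.add hinv).div_const 4) ?_
      norm_num; field_simp; ring
  intro s hs
  have hs0 : s ≠ 0 := (mem_Ioi.1 hs).ne'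
  rw [h1 s hs, h2 s hs, h3 s hs]
  simp only [mg]
  refine ⟨?_, ?_, ?_⟩ <;> field_simp <;> ring
end
end
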